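/- arXiv:1410.1698 — 2 statements merged into one kernel-verified Lean document; each statement's English description precedes it below -/
import Mathlib

section
/- Let Δ ⊂ ℝ² be a two-dimensional lattice polygon such that Δ^{(1)} is two-dimensional and such that Δ^{(1)} has exactly 3 lattice points on its boundary, i.e. #(∂Δ^{(1)} ∩ ℤ²) = 3. Then Δ^{(1)} is unimodularly equivalent to Σ or to Υ. -/
open Pointwise

noncomputable section

def toR (p : ℤ × ℤ) : ℝ × ℝ := ((p.1 : ℝ), (p.2 : ℝ))

def IsLatticePolygon (P : Set (ℝ × ℝ)) : Prop :=
  ∃ S : Finset (ℤ × ℤ), P = convexHull ℝ (toR '' ↑S)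

def latticePts (A : Set (ℝ × ℝ)) : Set (ℤ × ℤ) := {p | toR p ∈ A}

def interiorHull (P : Set (ℝ × ℝ)) : Set (ℝ × ℝ) :=
  convexHull ℝ (toR '' latticePts (interior P))

/-- Affine map `x ↦ M x + v` on `ℝ²` induced by `M ∈ Mat₂(ℤ)`, `v ∈ ℤ²`. -/
def unimodMap (M : Matrix (Fin 2) (Fin 2) ℤ) (v : ℤ × ℤ) (x : ℝ × ℝ) : ℝ × ℝ :=
  ((M 0 0 : ℝ) * x.1 + (M 0 1 : ℝ) * x.2 + (v.1 : ℝ),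
   (M 1 0 : ℝ) * x.1 + (M 1 1 : ℝ) * x.2 + (v.2 : ℝ))

def UnimodEquiv (P Q : Set (ℝ × ℝ)) : Prop :=
  ∃ (M : Matrix (Fin 2) (Fin 2) ℤ) (v : ℤ × ℤ), IsUnit M.det ∧ Q = unimodMap M v '' P

/-- The unimodular triangle `Σ = conv{(0,0),(1,0),(0,1)}`. -/
def SigmaTri : Set (ℝ × ℝ) :=
  convexHull ℝ {((0 : ℝ), (0 : ℝ)), ((1 : ℝ), (0 : ℝ)), ((0 : ℝ), (1 : ℝ))}

/-- The triangle `Υ = conv{(-1,-1),(1,0),(0,1)}`. -/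
def UpsilonTri : Set (ℝ × ℝ) :=
  convexHull ℝ {((-1 : ℝ), (-1 : ℝ)), ((1 : ℝ), (0 : ℝ)), ((0 : ℝ), (1 : ℝ))}

/-- The determinant `det (q - p, x - p)`, as a function of a real point `x`. -/
def edgeForm (p q : ℤ × ℤ) (x : ℝ × ℝ) : ℝ :=
  ((q.1 : ℝ) - p.1) * (x.2 - p.2) - ((q.2 : ℝ) - p.2) * (x.1 - p.1)

/-- The determinant `det (q - p, x - p)`, as a function of a lattice point `x`. -/
def latticeEdgeForm (p q x : ℤ × ℤ) : ℤ :=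
  (q.1 - p.1) * (x.2 - p.2) - (q.2 - p.2) * (x.1 - p.1)

lemma edgeForm_toR (p q x : ℤ × ℤ) : edgeForm p q (toR x) = (latticeEdgeForm p q x : ℝ) := by
  simp [edgeForm, latticeEdgeForm, toR]

/-- An affine function that is nonnegative on a set is positive on its interior. -/
lemma pos_of_mem_interior {U : Set (ℝ × ℝ)} {α β γ : ℝ} (hne : α ≠ 0 ∨ β ≠ 0)
    (hU : ∀ x ∈ U, 0 ≤ α * x.1 + β * x.2 + γ) {x : ℝ × ℝ} (hx : x ∈ interior U) :
    0 < α * x.1 + β * x.2 + γ := by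
  have hcont : Filter.Tendsto (fun t : ℝ => (x.1 - t * α, x.2 - t * β)) (nhds 0) (nhds x) := by
    have : Continuous (fun t : ℝ => (x.1 - t * α, x.2 - t * β)) := by fun_prop
    simpa using this.tendsto 0
  have hev : ∀ᶠ t in nhds (0 : ℝ), (x.1 - t * α, x.2 - t * β) ∈ U :=
    hcont.eventually (mem_interior_iff_mem_nhds.1 hx)
  obtain ⟨ε, hε, hball⟩ := Metric.eventually_nhds_iff.1 hev
  have hmem := hball (y := ε / 2) (by rw [Real.dist_eq, sub_zero, abs_of_pos] <;> linarith)
  have h := hU _ hmem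
  simp only at h
  have hsq : 0 < α ^ 2 + β ^ 2 := by
    rcases hne with h0 | h0
    · have := sq_pos_of_ne_zero h0
      positivity
    · have := sq_pos_of_ne_zero h0
      positivity
  nlinarith [mul_pos hε hsq]

lemma nonneg_of_mem_convexHull {S : Set (ℝ × ℝ)} {α β γ : ℝ}
    (hS : ∀ x ∈ S, 0 ≤ α * x.1 + β * x.2 + γ) {x : ℝ × ℝ} (hx : x ∈ convexHull ℝ S) :
    0 ≤ α * x.1 + β * x.2 + γ := by
  have hconv : Convex ℝ {x : ℝ × ℝ | 0 ≤ α * x.1 + β * x.2 + γ} := by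
    intro y hy z hz r s hr hs hrs
    simp only [Set.mem_ofPred_eq, Prod.fst_add, Prod.smul_fst, smul_eq_mul, Prod.snd_add,
      Prod.smul_snd] at *
    have : α * (r * y.1 + s * z.1) + β * (r * y.2 + s * z.2) + γ
        = r * (α * y.1 + β * y.2 + γ) + s * (α * z.1 + β * z.2 + γ) := by
      linear_combination -γ * hrs
    rw [this]
    positivity
  exact convexHull_min hS hconv hx

lemma edgeForm_eq (p q : ℤ × ℤ) (x : ℝ × ℝ) :
    edgeForm p q x = (-((q.2 : ℝ) - p.2)) * x.1 + ((q.1 : ℝ) - p.1) * x.2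
      + (-(((q.1 : ℝ) - p.1) * p.2) + ((q.2 : ℝ) - p.2) * p.1) := by
  unfold edgeForm
  ring

lemma edgeForm_nonneg_of_mem_convexHull {S : Set (ℝ × ℝ)} {p q : ℤ × ℤ}
    (hS : ∀ x ∈ S, 0 ≤ edgeForm p q x) {x : ℝ × ℝ} (hx : x ∈ convexHull ℝ S) :
    0 ≤ edgeForm p q x := by
  simp only [edgeForm_eq] at *
  exact nonneg_of_mem_convexHull hS hx

lemma edgeForm_pos_of_mem_interior {U : Set (ℝ × ℝ)} {p q : ℤ × ℤ} (hne : p ≠ q)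
    (hU : ∀ x ∈ U, 0 ≤ edgeForm p q x) {x : ℝ × ℝ} (hx : x ∈ interior U) :
    0 < edgeForm p q x := by
  simp only [edgeForm_eq] at *
  refine pos_of_mem_interior ?_ hU hx
  by_contra! h
  apply hne
  have h1 : (q.2 : ℝ) = p.2 := by linarith [h.1]
  have h2 : (q.1 : ℝ) = p.1 := by linarith [h.2]
  exact Prod.ext (by exact_mod_cast h2.symm) (by exact_mod_cast h1.symm)

/-- A lattice segment whose only lattice points are its endpoints is primitive. -/
lemma isCoprime_of_segment {a b : ℤ × ℤ} (hne : a ≠ b)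
    (h : ∀ q : ℤ × ℤ, toR q ∈ segment ℝ (toR a) (toR b) → q = a ∨ q = b) :
    IsCoprime (b.1 - a.1) (b.2 - a.2) := by
  rw [Int.isCoprime_iff_gcd_eq_one]
  set g := Int.gcd (b.1 - a.1) (b.2 - a.2) with hg
  have hg0 : g ≠ 0 := by
    intro h0
    rw [hg, Int.gcd_eq_zero_iff] at h0
    exact hne (Prod.ext (by linarith [h0.1]) (by linarith [h0.2]))
  obtain ⟨k, hk⟩ : (g : ℤ) ∣ b.1 - a.1 := Int.gcd_dvd_left _ _
  obtain ⟨l, hl⟩ : (g : ℤ) ∣ b.2 - a.2 := Int.gcd_dvd_right _ _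
  have hgpos : (1 : ℝ) ≤ g := by exact_mod_cast Nat.one_le_iff_ne_zero.2 hg0
  have hkR : (b.1 : ℝ) - a.1 = g * k := by exact_mod_cast hk
  have hlR : (b.2 : ℝ) - a.2 = g * l := by exact_mod_cast hl
  have hmem : toR (a.1 + k, a.2 + l) ∈ segment ℝ (toR a) (toR b) := by
    rw [segment_eq_image']
    refine ⟨1 / (g : ℝ), ⟨by positivity, ?_⟩, ?_⟩
    · rw [div_le_one (by linarith)]
      exact hgpos
    · ext
      · simp only [toR, Prod.fst_add, Prod.smul_fst, Prod.fst_sub, smul_eq_mul, hkR]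
        push_cast
        field_simp
      · simp only [toR, Prod.snd_add, Prod.smul_snd, Prod.snd_sub, smul_eq_mul, hlR]
        push_cast
        field_simp
  have hkl : k ≠ 0 ∨ l ≠ 0 := by
    by_contra! h0
    apply hne
    rw [h0.1] at hk
    rw [h0.2] at hl
    exact Prod.ext (by linarith) (by linarith)
  have hgone : (g : ℤ) = 1 := by
    rcases h _ hmem with h1 | h1
    · have e1 := congrArg Prod.fst h1
      have e2 := congrArg Prod.snd h1
      simp only at e1 e2
      omega
    · have e1 := congrArg Prod.fst h1
      have e2 := congrArg Prod.snd h1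
      simp only at e1 e2
      rcases hkl with h0 | h0
      · apply mul_right_cancel₀ h0
        linarith
      · apply mul_right_cancel₀ h0
        linarith
  exact_mod_cast hgone

/-- If a primitive edge `ab` of the hull of the interior lattice points lies in the interior of
a convex set, then the lattice points of that set are at lattice height at least `-1`. -/
lemma neg_one_le_latticeEdgeForm {Δ : Set (ℝ × ℝ)} (hΔ : Convex ℝ Δ) {a b : ℤ × ℤ}
    (ha : toR a ∈ interior Δ) (hb : toR b ∈ interior Δ)
    (hcop : IsCoprime (b.1 - a.1) (b.2 - a.2))
    (hpos : ∀ q : ℤ × ℤ, toR q ∈ interior Δ → 0 ≤ latticeEdgeForm a b q)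
    {p : ℤ × ℤ} (hp : toR p ∈ Δ) : -1 ≤ latticeEdgeForm a b p := by
  by_contra! hlt
  obtain ⟨r, s, hrs⟩ := hcop
  set h := -latticeEdgeForm a b p with hh
  have h2 : 2 ≤ h := by omega
  set k := r * (p.1 - a.1) + s * (p.2 - a.2) with hk
  have hp1 : p.1 - a.1 = k * (b.1 - a.1) + h * s := by
    rw [hk, hh, latticeEdgeForm]
    linear_combination (-(p.1 - a.1)) * hrs
  have hp2 : p.2 - a.2 = k * (b.2 - a.2) - h * r := by
    rw [hk, hh, latticeEdgeForm]
    linear_combination (-(p.2 - a.2)) * hrs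
  obtain ⟨x, hx0, hx1⟩ : ∃ x : ℤ, 0 ≤ h * x - k ∧ h * x - k ≤ h - 1 := by
    refine ⟨-((-k) / h), ?_, ?_⟩
    · have := Int.mul_ediv_add_emod (-k) h
      have := Int.emod_nonneg (-k) (show h ≠ 0 by omega)
      linarith
    · have := Int.mul_ediv_add_emod (-k) h
      have := Int.emod_lt_of_pos (-k) (show 0 < h by omega)
      linarith
  set q : ℤ × ℤ := (a.1 + x * (b.1 - a.1) + s, a.2 + x * (b.2 - a.2) - r) with hq
  have hqform : latticeEdgeForm a b q = -1 := by
    simp only [latticeEdgeForm, hq]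
    linear_combination -hrs
  have hR : (2 : ℝ) ≤ h := by exact_mod_cast h2
  have hx0R : (0 : ℝ) ≤ h * x - k := by exact_mod_cast hx0
  have hx1R : (h : ℝ) * x - k ≤ h - 1 := by exact_mod_cast hx1
  have hp1R : (p.1 : ℝ) = a.1 + (k * (b.1 - a.1) + h * s) := by
    have : (p.1 : ℝ) - a.1 = k * (b.1 - a.1) + h * s := by exact_mod_cast hp1
    linarith
  have hp2R : (p.2 : ℝ) = a.2 + (k * (b.2 - a.2) - h * r) := by
    have : (p.2 : ℝ) - a.2 = k * (b.2 - a.2) - h * r := by exact_mod_cast hp2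
    linarith
  have h0 : (h : ℝ) ≠ 0 := by linarith
  have h1 : (h : ℝ) - 1 ≠ 0 := by linarith
  have h1pos : (0 : ℝ) < h - 1 := by linarith
  set t : ℝ := (h * x - k) / (h - 1) with ht
  have hz : (1 - t) • toR a + t • toR b ∈ interior Δ := by
    refine hΔ.interior ha hb ?_ ?_ (by ring)
    · rw [ht, sub_nonneg, div_le_one h1pos]
      exact hx1R
    · rw [ht]
      positivity
  have hqmem : toR q ∈ interior Δ := by
    have := hΔ.combo_self_interior_mem_interior hp hz (a := 1 / (h : ℝ)) (b := (h - 1) / (h : ℝ))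
      (by positivity) (by positivity) (by field_simp; ring)
    convert this using 1
    ext
    · simp only [toR, hq, Prod.fst_add, Prod.smul_fst, smul_eq_mul, hp1R, ht]
      push_cast
      field_simp
      ring
    · simp only [toR, hq, Prod.snd_add, Prod.smul_snd, smul_eq_mul, hp2R, ht]
      push_cast
      field_simp
      ring
  have := hpos q hqmem
  omega

/-- At a vertex `a` of the triangle `abc`, the two adjacent edges moved out by one meet in a
lattice point. -/
lemma dvd_of_vertex {Δ : Set (ℝ × ℝ)} (hpoly : IsLatticePolygon Δ) {a b c : ℤ × ℤ}
    (ha : toR a ∈ interior Δ) (hb : toR b ∈ interior Δ) (hc : toR c ∈ interior Δ)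
    (hD : 0 < latticeEdgeForm a b c)
    (hab : IsCoprime (b.1 - a.1) (b.2 - a.2)) (hca : IsCoprime (a.1 - c.1) (a.2 - c.2))
    (hposab : ∀ q : ℤ × ℤ, toR q ∈ interior Δ → 0 ≤ latticeEdgeForm a b q)
    (hposca : ∀ q : ℤ × ℤ, toR q ∈ interior Δ → 0 ≤ latticeEdgeForm c a q) :
    latticeEdgeForm a b c ∣ b.1 + c.1 - 2 * a.1 ∧
      latticeEdgeForm a b c ∣ b.2 + c.2 - 2 * a.2 := by
  obtain ⟨S, rfl⟩ := hpoly
  obtain ⟨s, hsS, hs⟩ : ∃ s ∈ S, latticeEdgeForm a b s + latticeEdgeForm c a s < 0 := by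
    by_contra! hcon
    have hne : b ≠ c := by
      rintro rfl
      simp only [latticeEdgeForm] at hD
      nlinarith
    have hbc : ∀ y, edgeForm a b y + edgeForm c a y
        = edgeForm c b y - edgeForm c b (toR a) := by
      intro y
      simp only [edgeForm, toR]
      ring
    have key : ∀ y ∈ convexHull ℝ (toR '' (S : Set (ℤ × ℤ))),
        0 ≤ (-((b.2 : ℝ) - c.2)) * y.1 + ((b.1 : ℝ) - c.1) * y.2
          + (((b.2 : ℝ) - c.2) * a.1 - ((b.1 : ℝ) - c.1) * a.2) := by
      intro y hy
      refine nonneg_of_mem_convexHull ?_ hy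
      rintro _ ⟨s, hs, rfl⟩
      have h1 := hcon s hs
      have h2 : (0 : ℝ) ≤ edgeForm a b (toR s) + edgeForm c a (toR s) := by
        rw [edgeForm_toR, edgeForm_toR]
        exact_mod_cast h1
      rw [hbc] at h2
      simp only [edgeForm, toR] at h2 ⊢
      linarith
    have := pos_of_mem_interior (by
      by_contra! h
      apply hne
      have h1 : (b.2 : ℝ) = c.2 := by linarith [h.1]
      have h2 : (b.1 : ℝ) = c.1 := by linarith [h.2]
      exact Prod.ext (by exact_mod_cast h2) (by exact_mod_cast h1)) key ha
    simp only [toR] at this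
    linarith
  have hsΔ : toR s ∈ convexHull ℝ (toR '' (S : Set (ℤ × ℤ))) :=
    subset_convexHull ℝ _ ⟨s, hsS, rfl⟩
  have h1 := neg_one_le_latticeEdgeForm (convex_convexHull ℝ _) ha hb hab hposab hsΔ
  have h2 := neg_one_le_latticeEdgeForm (convex_convexHull ℝ _) hc ha hca hposca hsΔ
  have e1 : latticeEdgeForm a b c * (s.1 - a.1)
      = latticeEdgeForm c a s * (b.1 - a.1) + latticeEdgeForm a b s * (c.1 - a.1) := by
    simp only [latticeEdgeForm]
    ring
  have e2 : latticeEdgeForm a b c * (s.2 - a.2)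
      = latticeEdgeForm c a s * (b.2 - a.2) + latticeEdgeForm a b s * (c.2 - a.2) := by
    simp only [latticeEdgeForm]
    ring
  have hcases : (latticeEdgeForm a b s = -1 ∧ latticeEdgeForm c a s = -1) ∨
      (latticeEdgeForm a b s = -1 ∧ latticeEdgeForm c a s = 0) ∨
      (latticeEdgeForm a b s = 0 ∧ latticeEdgeForm c a s = -1) := by omega
  rcases hcases with ⟨h3, h4⟩ | ⟨h3, h4⟩ | ⟨h3, h4⟩
  · rw [h3, h4] at e1 e2
    exact ⟨⟨-(s.1 - a.1), by linarith⟩, ⟨-(s.2 - a.2), by linarith⟩⟩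
  · rw [h3, h4] at e1 e2
    have hu := hca.isUnit_of_dvd' (x := latticeEdgeForm a b c)
      ⟨s.1 - a.1, by linarith⟩ ⟨s.2 - a.2, by linarith⟩
    exact ⟨hu.dvd, hu.dvd⟩
  · rw [h3, h4] at e1 e2
    have hu := hab.isUnit_of_dvd' (x := latticeEdgeForm a b c)
      ⟨-(s.1 - a.1), by linarith⟩ ⟨-(s.2 - a.2), by linarith⟩
    exact ⟨hu.dvd, hu.dvd⟩

lemma unimodMap_image_convexHull (M : Matrix (Fin 2) (Fin 2) ℤ) (v : ℤ × ℤ)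
    (S : Set (ℝ × ℝ)) :
    unimodMap M v '' convexHull ℝ S = convexHull ℝ (unimodMap M v '' S) := by
  have hlin : IsLinearMap ℝ (unimodMap M 0) := by
    constructor
    · intro x y
      ext <;> simp [unimodMap] <;> ring
    · intro r x
      ext <;> simp [unimodMap] <;> ring
  have hsplit : unimodMap M v = fun x => toR v + (hlin.mk' _) x := by
    funext x
    ext <;> simp [unimodMap, toR] <;> ring
  have hcomp : unimodMap M v = (AffineMap.const ℝ (ℝ × ℝ) (toR v) +
      (hlin.mk' _).toAffineMap : (ℝ × ℝ) →ᵃ[ℝ] (ℝ × ℝ)) := by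
    rw [hsplit]
    rfl
  rw [hcomp]
  exact AffineMap.image_convexHull _ _

/-- If `b - m`, `c - m` is a positively oriented lattice basis, the triangle `abc` is equivalent
to the triangle whose vertices are `(1, 0)`, `(0, 1)` and the coordinates of `a - m`. -/
lemma unimodEquiv_of_basis {a b c m : ℤ × ℤ} (h : latticeEdgeForm m b c = 1) :
    UnimodEquiv (convexHull ℝ {toR a, toR b, toR c})
      (convexHull ℝ {toR (-latticeEdgeForm m c a, latticeEdgeForm m b a), (1, 0), (0, 1)}) := by
  have hR : (latticeEdgeForm m b c : ℝ) = 1 := by exact_mod_cast h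
  simp only [latticeEdgeForm] at h hR
  push_cast at hR
  refine ⟨!![c.2 - m.2, -(c.1 - m.1); -(b.2 - m.2), b.1 - m.1],
    (-((c.2 - m.2) * m.1) + (c.1 - m.1) * m.2, (b.2 - m.2) * m.1 - (b.1 - m.1) * m.2), ?_, ?_⟩
  · rw [Matrix.det_fin_two_of]
    rw [Int.isUnit_iff]
    left
    linarith
  · rw [unimodMap_image_convexHull, Set.image_insert_eq, Set.image_pair]
    congr 2
    · ext <;> simp [unimodMap, toR, latticeEdgeForm] <;> ring
    · congr 1
      · ext
        · simp [unimodMap, toR]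
          linarith
        · simp [unimodMap, toR]
          ring
      · congr 1
        ext
        · simp [unimodMap, toR]
          ring
        · simp [unimodMap, toR]
          linarith

lemma unimodEquiv_of_primitive_triangle {Δ : Set (ℝ × ℝ)} (hpoly : IsLatticePolygon Δ)
    {a b c : ℤ × ℤ}
    (ha : toR a ∈ interior Δ) (hb : toR b ∈ interior Δ) (hc : toR c ∈ interior Δ)
    (hhull : interiorHull Δ = convexHull ℝ {toR a, toR b, toR c})
    (hD : 0 < latticeEdgeForm a b c)
    (hfr : ∀ q : ℤ × ℤ, toR q ∈ frontier (interiorHull Δ) → q = a ∨ q = b ∨ q = c) :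
    UnimodEquiv (interiorHull Δ) SigmaTri ∨ UnimodEquiv (interiorHull Δ) UpsilonTri := by
  have hnonneg : ∀ {p q : ℤ × ℤ}, 0 ≤ latticeEdgeForm p q a → 0 ≤ latticeEdgeForm p q b →
      0 ≤ latticeEdgeForm p q c → ∀ x ∈ interiorHull Δ, 0 ≤ edgeForm p q x := by
    intro p q h1 h2 h3 x hx
    rw [hhull] at hx
    refine edgeForm_nonneg_of_mem_convexHull ?_ hx
    rintro y (rfl | rfl | rfl) <;> rw [edgeForm_toR] <;> exact_mod_cast ‹_›
  have hsub : ∀ p : ℤ × ℤ, toR p ∈ interior Δ → toR p ∈ interiorHull Δ := fun p hp =>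
    subset_convexHull ℝ _ ⟨p, hp, rfl⟩
  have hcyc1 : latticeEdgeForm b c a = latticeEdgeForm a b c := by
    simp only [latticeEdgeForm]
    ring
  have hcyc2 : latticeEdgeForm c a b = latticeEdgeForm a b c := by
    simp only [latticeEdgeForm]
    ring
  have hleft : ∀ p q : ℤ × ℤ, latticeEdgeForm p q p = 0 := by
    intro p q
    simp only [latticeEdgeForm]
    ring
  have hright : ∀ p q : ℤ × ℤ, latticeEdgeForm p q q = 0 := by
    intro p q
    simp only [latticeEdgeForm]
    ring
  have hab := hnonneg (p := a) (q := b) (hleft _ _).ge (hright _ _).ge hD.le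
  have hbc := hnonneg (p := b) (q := c) (hcyc1 ▸ hD.le) (hleft _ _).ge (hright _ _).ge
  have hca := hnonneg (p := c) (q := a) (hright _ _).ge (hcyc2 ▸ hD.le) (hleft _ _).ge
  have hlat : ∀ {p q : ℤ × ℤ}, (∀ x ∈ interiorHull Δ, 0 ≤ edgeForm p q x) →
      ∀ y : ℤ × ℤ, toR y ∈ interior Δ → 0 ≤ latticeEdgeForm p q y := by
    intro p q h y hy
    have := h (toR y) (hsub y hy)
    rw [edgeForm_toR] at this
    exact_mod_cast this
  have hseg : ∀ {p q r : ℤ × ℤ}, 0 < latticeEdgeForm p q r →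
      (∀ x ∈ interiorHull Δ, 0 ≤ edgeForm p q x) →
      toR p ∈ interior Δ → toR q ∈ interior Δ →
      (∀ y : ℤ × ℤ, toR y ∈ frontier (interiorHull Δ) → y = p ∨ y = q ∨ y = r) →
      IsCoprime (q.1 - p.1) (q.2 - p.2) := by
    intro p q r hr hnn hp hq hfr
    have hne : p ≠ q := by
      rintro rfl
      simp [latticeEdgeForm] at hr
    refine isCoprime_of_segment hne fun y hy => ?_
    have hyT : toR y ∈ interiorHull Δ :=
      (convex_convexHull ℝ _).segment_subset (hsub p hp) (hsub q hq) hy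
    have hy0 : edgeForm p q (toR y) = 0 := by
      rw [segment_eq_image'] at hy
      obtain ⟨t, -, ht⟩ := hy
      rw [← ht]
      simp only [edgeForm, toR, Prod.fst_add, Prod.smul_fst, Prod.fst_sub, smul_eq_mul,
        Prod.snd_add, Prod.smul_snd, Prod.snd_sub]
      ring
    have hyfr : toR y ∈ frontier (interiorHull Δ) :=
      ⟨subset_closure hyT, fun hin => (edgeForm_pos_of_mem_interior hne hnn hin).ne' hy0⟩
    rcases hfr y hyfr with h | h | rfl
    · exact Or.inl h
    · exact Or.inr h
    · rw [edgeForm_toR] at hy0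
      have : latticeEdgeForm p q y = 0 := by exact_mod_cast hy0
      omega
  have cab := hseg hD hab ha hb hfr
  have cbc := hseg (hcyc1 ▸ hD) hbc hb hc fun y hy => by
    rcases hfr y hy with h | h | h <;> simp [h]
  have cca := hseg (hcyc2 ▸ hD) hca hc ha fun y hy => by
    rcases hfr y hy with h | h | h <;> simp [h]
  obtain ⟨da1, da2⟩ := dvd_of_vertex hpoly ha hb hc hD cab cca (hlat hab) (hlat hca)
  obtain ⟨db1, db2⟩ := dvd_of_vertex hpoly hb hc ha (hcyc1 ▸ hD) cbc cab (hlat hbc) (hlat hab)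
  rw [hcyc1] at db1 db2
  have hD3 : latticeEdgeForm a b c ∣ 3 := by
    obtain ⟨r, s, hrs⟩ := cab
    have e1 := (dvd_sub da1 db1).mul_left r
    have e2 := (dvd_sub da2 db2).mul_left s
    have e3 := dvd_add e1 e2
    rwa [show r * (b.1 + c.1 - 2 * a.1 - (c.1 + a.1 - 2 * b.1))
      + s * (b.2 + c.2 - 2 * a.2 - (c.2 + a.2 - 2 * b.2)) = 3 by
        linear_combination 3 * hrs] at e3
  have hD13 : latticeEdgeForm a b c = 1 ∨ latticeEdgeForm a b c = 3 := by
    have hle := Int.le_of_dvd (by norm_num) hD3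
    generalize latticeEdgeForm a b c = D at *
    interval_cases D <;> omega
  rw [hhull]
  rcases hD13 with h1 | h3
  · left
    have := unimodEquiv_of_basis (a := a) h1
    rw [hleft, hleft] at this
    simpa [SigmaTri, toR] using this
  · right
    rw [h3] at da1 da2
    obtain ⟨k, hk⟩ := da1
    obtain ⟨l, hl⟩ := da2
    have hc1 : c.1 = 3 * k + 2 * a.1 - b.1 := by linarith
    have hc2 : c.2 = 3 * l + 2 * a.2 - b.2 := by linarith
    simp only [latticeEdgeForm, hc1, hc2] at h3
    have hm : latticeEdgeForm (a.1 + k, a.2 + l) b c = 1 := by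
      simp only [latticeEdgeForm, hc1, hc2]
      linarith
    have := unimodEquiv_of_basis (a := a) hm
    have f1 : -latticeEdgeForm (a.1 + k, a.2 + l) c a = -1 := by
      simp only [latticeEdgeForm, hc1, hc2]
      linarith
    have f2 : latticeEdgeForm (a.1 + k, a.2 + l) b a = -1 := by
      simp only [latticeEdgeForm]
      linarith
    rw [f1, f2] at this
    simpa [UpsilonTri, toR] using this

lemma finite_latticePts_of_isBounded {A : Set (ℝ × ℝ)} (hA : Bornology.IsBounded A) :
    (latticePts A).Finite := by
  obtain ⟨R, hR⟩ := hA.subset_closedBall 0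
  refine (Set.finite_Icc ((-⌈R⌉, -⌈R⌉) : ℤ × ℤ) (⌈R⌉, ⌈R⌉)).subset fun p hp => ?_
  have h := hR hp
  rw [Metric.mem_closedBall, dist_zero_right, Prod.norm_def, max_le_iff, Real.norm_eq_abs,
    Real.norm_eq_abs, abs_le, abs_le] at h
  obtain ⟨⟨h1, h2⟩, h3, h4⟩ := h
  simp only [toR] at h1 h2 h3 h4
  have hc := Int.le_ceil R
  have e1 : -⌈R⌉ ≤ p.1 := by
    have : (-(⌈R⌉ : ℝ)) ≤ p.1 := by linarith
    exact_mod_cast this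
  have e2 : p.1 ≤ ⌈R⌉ := by
    have : (p.1 : ℝ) ≤ ⌈R⌉ := by linarith
    exact_mod_cast this
  have e3 : -⌈R⌉ ≤ p.2 := by
    have : (-(⌈R⌉ : ℝ)) ≤ p.2 := by linarith
    exact_mod_cast this
  have e4 : p.2 ≤ ⌈R⌉ := by
    have : (p.2 : ℝ) ≤ ⌈R⌉ := by linarith
    exact_mod_cast this
  exact ⟨⟨e1, e3⟩, ⟨e2, e4⟩⟩

lemma collinear_of_latticeEdgeForm_eq_zero {a b c : ℤ × ℤ} (hne : a ≠ b)
    (h : latticeEdgeForm a b c = 0) :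
    Collinear ℝ (convexHull ℝ {toR a, toR b, toR c}) := by
  have hcol : Collinear ℝ {toR a, toR b, toR c} := by
    rw [collinear_iff_of_mem (p₀ := toR a) (by simp)]
    have hR : ((latticeEdgeForm a b c : ℤ) : ℝ) = 0 := by exact_mod_cast h
    simp only [latticeEdgeForm] at hR
    push_cast at hR
    refine ⟨toR b - toR a, ?_⟩
    rintro p (rfl | rfl | rfl)
    · exact ⟨0, by simp⟩
    · exact ⟨1, by simp⟩
    · have hne' : ((b.1 : ℝ) - a.1 ≠ 0) ∨ ((b.2 : ℝ) - a.2 ≠ 0) := by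
        by_contra! h0
        apply hne
        have h1 : (a.1 : ℝ) = b.1 := by linarith [h0.1]
        have h2 : (a.2 : ℝ) = b.2 := by linarith [h0.2]
        exact Prod.ext (by exact_mod_cast h1) (by exact_mod_cast h2)
      rcases hne' with h0 | h0
      · refine ⟨((c.1 : ℝ) - a.1) / (b.1 - a.1), ?_⟩
        ext
        · simp [toR]
          field_simp
          ring
        · simp [toR]
          field_simp
          linarith
      · refine ⟨((c.2 : ℝ) - a.2) / (b.2 - a.2), ?_⟩
        ext
        · simp [toR]
          field_simp
          linarith
        · simp [toR]
          field_simp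
          ring
  unfold Collinear at hcol ⊢
  rwa [← direction_affineSpan, affineSpan_convexHull, direction_affineSpan]

/-- The convex hull of finitely many lattice points is spanned by its boundary lattice points. -/
lemma convexHull_eq_convexHull_latticePts_frontier {L : Set (ℤ × ℤ)} (hL : L.Finite) :
    convexHull ℝ (toR '' L)
      = convexHull ℝ (toR '' latticePts (frontier (convexHull ℝ (toR '' L)))) := by
  have hfin : (toR '' L).Finite := hL.image _
  have hcpt : IsCompact (convexHull ℝ (toR '' L)) := hfin.isCompact_convexHull ℝ
  have hext : (convexHull ℝ (toR '' L)).extremePoints ℝ ⊆ toR '' L :=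
    extremePoints_convexHull_subset
  apply Set.Subset.antisymm
  · conv_lhs => rw [← closure_convexHull_extremePoints hcpt (convex_convexHull ℝ _)]
    rw [((hfin.subset hext).isClosed_convexHull ℝ).closure_eq]
    refine convexHull_mono fun x hx => ?_
    obtain ⟨p, -, rfl⟩ := hext hx
    refine ⟨p, ⟨subset_closure (extremePoints_subset hx), fun hin => ?_⟩, rfl⟩
    exact Set.disjoint_left.1 (disjoint_interior_extremePoints _) hin hx
  · refine convexHull_min ?_ (convex_convexHull ℝ _)
    rintro _ ⟨p, hp, rfl⟩
    exact hcpt.isClosed.frontier_subset hp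

theorem stmt8 (Δ : Set (ℝ × ℝ))
    (hpoly : IsLatticePolygon Δ) (hdim : ¬ Collinear ℝ Δ)
    (hdim1 : ¬ Collinear ℝ (interiorHull Δ))
    (hb : (latticePts (frontier (interiorHull Δ))).ncard = 3) :
    UnimodEquiv (interiorHull Δ) SigmaTri ∨ UnimodEquiv (interiorHull Δ) UpsilonTri := by
  have hbdd : Bornology.IsBounded Δ := by
    obtain ⟨S, rfl⟩ := hpoly
    exact isBounded_convexHull.2 (S.finite_toSet.image _).isBounded
  have hfin : (latticePts (interior Δ)).Finite :=
    finite_latticePts_of_isBounded (hbdd.subset interior_subset)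
  have hΔ : Convex ℝ Δ := by
    obtain ⟨S, rfl⟩ := hpoly
    exact convex_convexHull ℝ _
  have hsub : interiorHull Δ ⊆ interior Δ := by
    refine convexHull_min ?_ hΔ.interior
    rintro _ ⟨p, hp, rfl⟩
    exact hp
  have hclosed : IsClosed (interiorHull Δ) := (hfin.image _).isClosed_convexHull ℝ
  have hspan : interiorHull Δ
      = convexHull ℝ (toR '' latticePts (frontier (interiorHull Δ))) :=
    convexHull_eq_convexHull_latticePts_frontier hfin
  obtain ⟨a, b, c, hab, hac, hbc, hB⟩ := Set.ncard_eq_three.1 hb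
  have hfr : ∀ q : ℤ × ℤ, toR q ∈ frontier (interiorHull Δ) ↔ q = a ∨ q = b ∨ q = c := by
    intro q
    change q ∈ latticePts (frontier (interiorHull Δ)) ↔ _
    rw [hB]
    rfl
  have hmem : ∀ q : ℤ × ℤ, q = a ∨ q = b ∨ q = c → toR q ∈ interior Δ := fun q hq =>
    hsub (hclosed.frontier_subset ((hfr q).2 hq))
  have hhull : interiorHull Δ = convexHull ℝ {toR a, toR b, toR c} := by
    rw [hB, Set.image_insert_eq, Set.image_pair] at hspan
    exact hspan
  have hD : latticeEdgeForm a b c ≠ 0 := fun h0 =>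
    hdim1 (hhull ▸ collinear_of_latticeEdgeForm_eq_zero hab h0)
  rcases hD.lt_or_gt with hneg | hpos
  · refine unimodEquiv_of_primitive_triangle hpoly (a := a) (b := c) (c := b) (hmem _ (by simp))
      (hmem _ (by simp)) (hmem _ (by simp)) ?_ ?_ fun q hq => ?_
    · rw [hhull, Set.pair_comm]
    · simp only [latticeEdgeForm] at hneg ⊢
      linarith
    · rcases (hfr q).1 hq with h | h | h <;> simp [h]
  · exact unimodEquiv_of_primitive_triangle hpoly (hmem _ (by simp)) (hmem _ (by simp))
      (hmem _ (by simp)) hhull hpos fun q hq => (hfr q).1 hq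
end
end

section
/- Let P ⊂ ℝ² be a two-dimensional lattice polygon whose topological interior contains no lattice points. Then #(int(2P) ∩ ℤ²) = #(P ∩ ℤ²) − 3, where int denotes the topological interior and 2P = {2·x : x ∈ P}. -/
open Pointwise

noncomputable section

/-- The signed double area of the triangle `a b x`; as a function of `x`, an affine form vanishing
on the line through `a` and `b`. -/
def area (a b x : ℝ × ℝ) : ℝ := (b.1 - a.1) * (x.2 - a.2) - (b.2 - a.2) * (x.1 - a.1)

lemma area_swap (a b x : ℝ × ℝ) : area b a x = -area a b x := by
  simp only [area]; ring

lemma area_rotate (a b x : ℝ × ℝ) : area b x a = area a b x := by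
  simp only [area]; ring

lemma area_combo (a b x y : ℝ × ℝ) {r s : ℝ} (h : r + s = 1) :
    area a b (r • x + s • y) = r * area a b x + s * area a b y := by
  obtain rfl : r = 1 - s := by linarith
  simp only [area, Prod.fst_add, Prod.snd_add, Prod.smul_fst, Prod.smul_snd, smul_eq_mul]
  ring

lemma continuous_area (a b : ℝ × ℝ) : Continuous (area a b) := by
  unfold area; fun_prop

lemma convex_area_nonneg (a b : ℝ × ℝ) : Convex ℝ {x | 0 ≤ area a b x} := by
  intro x hx y hy r s hr hs h
  simp only [Set.mem_ofPred_eq] at *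
  rw [area_combo _ _ _ _ h]; positivity

lemma convex_area_neg (a b : ℝ × ℝ) : Convex ℝ {x | area a b x < 0} := by
  intro x hx y hy r s hr hs h
  simp only [Set.mem_ofPred_eq] at *
  rw [area_combo _ _ _ _ h]
  rcases hr.eq_or_lt with rfl | hr
  · obtain rfl : s = 1 := by linarith
    linarith
  · nlinarith

lemma interior_area_nonneg {a b : ℝ × ℝ} (hab : a ≠ b) :
    interior {x | 0 ≤ area a b x} = {x | 0 < area a b x} := by
  apply subset_antisymm
  · intro x hx
    let d : ℝ × ℝ := (b.2 - a.2, -(b.1 - a.1))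
    have hc : Continuous fun ε : ℝ => x + ε • d := by fun_prop
    have hn : ∀ᶠ ε in nhds (0 : ℝ), x + ε • d ∈ interior {x | 0 ≤ area a b x} :=
      hc.continuousAt.eventually_mem (isOpen_interior.mem_nhds (by simpa using hx))
    obtain ⟨ε, h, hε⟩ := ((hn.filter_mono nhdsWithin_le_nhds).and
      (self_mem_nhdsWithin (s := Set.Ioi (0 : ℝ)))).exists
    have h := interior_subset h
    simp only [Set.mem_ofPred_eq] at *
    have hpos : 0 < (b.1 - a.1) ^ 2 + (b.2 - a.2) ^ 2 := by
      by_contra hle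
      apply hab
      ext <;> nlinarith [sq_nonneg (b.1 - a.1), sq_nonneg (b.2 - a.2)]
    have he : area a b (x + ε • d) = area a b x - ε * ((b.1 - a.1) ^ 2 + (b.2 - a.2) ^ 2) := by
      simp only [area, d, Prod.fst_add, Prod.snd_add, Prod.smul_fst, Prod.smul_snd, smul_eq_mul]
      ring
    rw [he] at h
    nlinarith [mul_pos hε hpos]
  · exact interior_maximal (fun x (hx : 0 < area a b x) => (hx.le : 0 ≤ area a b x))
      (isOpen_lt continuous_const (continuous_area a b))

lemma area_pos_of_mem_interior {a b x : ℝ × ℝ} {K : Set (ℝ × ℝ)} (hab : a ≠ b)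
    (hK : ∀ y ∈ K, 0 ≤ area a b y) (hx : x ∈ interior K) : 0 < area a b x := by
  have := interior_mono (t := {x | 0 ≤ area a b x}) hK hx
  rwa [interior_area_nonneg hab] at this

lemma area_nonneg_of_mem_convexHull {a b x : ℝ × ℝ} {T : Set (ℝ × ℝ)}
    (hT : ∀ y ∈ T, 0 ≤ area a b y) (hx : x ∈ convexHull ℝ T) : 0 ≤ area a b x :=
  convexHull_min (t := {x | 0 ≤ area a b x}) hT (convex_area_nonneg a b) hx

/-- Cramer's rule: the barycentric coordinates of `x` in the triangle `u v w`. -/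
lemma area_smul_eq (u v w x : ℝ × ℝ) :
    area u v w • x = area v w x • u + area w u x • v + area u v x • w := by
  ext <;> simp only [area, Prod.fst_add, Prod.snd_add, Prod.smul_fst, Prod.smul_snd,
    smul_eq_mul] <;> ring

lemma area_add_area_add_area (u v w x : ℝ × ℝ) :
    area v w x + area w u x + area u v x = area u v w := by
  simp only [area]; ring

lemma eq_combo_of_area_ne_zero {u v w : ℝ × ℝ} (x : ℝ × ℝ) (h : area u v w ≠ 0) :
    x = (area v w x / area u v w) • u + (area w u x / area u v w) • v
      + (area u v x / area u v w) • w := by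
  have h1 := congrArg ((area u v w)⁻¹ • ·) (area_smul_eq u v w x)
  simpa only [smul_smul, smul_add, inv_mul_cancel₀ h, one_smul, ← div_eq_inv_mul] using h1

lemma mem_of_area_nonneg {K : Set (ℝ × ℝ)} (hK : Convex ℝ K) {u v w x : ℝ × ℝ} (hu : u ∈ K)
    (hv : v ∈ K) (hw : w ∈ K) (h : 0 < area u v w) (h1 : 0 ≤ area v w x) (h2 : 0 ≤ area w u x)
    (h3 : 0 ≤ area u v x) : x ∈ K := by
  rw [eq_combo_of_area_ne_zero x h.ne']
  have hs := area_add_area_add_area u v w x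
  have := hK.sum_mem (t := Finset.univ)
    (w := ![area v w x / area u v w, area w u x / area u v w, area u v x / area u v w])
    (z := ![u, v, w]) ?_ ?_ ?_
  · simpa [Fin.sum_univ_three] using this
  · intro i _; fin_cases i <;> simp <;> positivity
  · simp only [Fin.sum_univ_three, Matrix.cons_val]
    field_simp; linarith
  · intro i _; fin_cases i <;> simpa

lemma mem_interior_of_area_pos {K : Set (ℝ × ℝ)} (hK : Convex ℝ K) {u v w x : ℝ × ℝ} (hu : u ∈ K)
    (hv : v ∈ K) (hw : w ∈ K) (h1 : 0 < area v w x) (h2 : 0 < area w u x)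
    (h3 : 0 < area u v x) : x ∈ interior K := by
  have h : 0 < area u v w := by linarith [area_add_area_add_area u v w x]
  refine interior_maximal (s := K) (t := {y | 0 < area v w y} ∩ {y | 0 < area w u y} ∩
    {y | 0 < area u v y}) ?_ ?_ ⟨⟨h1, h2⟩, h3⟩
  · rintro y ⟨⟨h1, h2⟩, h3⟩
    exact mem_of_area_nonneg hK hu hv hw h h1.le h2.le h3.le
  · exact ((isOpen_lt continuous_const (continuous_area _ _)).inter
      (isOpen_lt continuous_const (continuous_area _ _))).inter
      (isOpen_lt continuous_const (continuous_area _ _))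

lemma combo_mem_interior {K : Set (ℝ × ℝ)} (hK : Convex ℝ K) {u v w : ℝ × ℝ} (hu : u ∈ K)
    (hv : v ∈ K) (hw : w ∈ K) (h : area u v w ≠ 0) {r s t : ℝ} (hr : 0 < r) (hs : 0 < s)
    (ht : 0 < t) (hsum : r + s + t = 1) : r • u + s • v + t • w ∈ interior K := by
  have e1 : area v w (r • u + s • v + t • w) = r * area u v w := by
    obtain rfl : r = 1 - s - t := by linarith
    simp only [area, Prod.fst_add, Prod.snd_add, Prod.smul_fst, Prod.smul_snd, smul_eq_mul]; ring
  have e2 : area w u (r • u + s • v + t • w) = s * area u v w := by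
    obtain rfl : r = 1 - s - t := by linarith
    simp only [area, Prod.fst_add, Prod.snd_add, Prod.smul_fst, Prod.smul_snd, smul_eq_mul]; ring
  have e3 : area u v (r • u + s • v + t • w) = t * area u v w := by
    obtain rfl : r = 1 - s - t := by linarith
    simp only [area, Prod.fst_add, Prod.snd_add, Prod.smul_fst, Prod.smul_snd, smul_eq_mul]; ring
  rcases h.lt_or_gt with h | h
  · have h' : 0 < -area u v w := by linarith
    refine mem_interior_of_area_pos hK hv hu hw ?_ ?_ ?_
    · rw [area_swap, e2, ← mul_neg]; positivity
    · rw [area_swap, e1, ← mul_neg]; positivity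
    · rw [area_swap, e3, ← mul_neg]; positivity
  · refine mem_interior_of_area_pos hK hu hv hw ?_ ?_ ?_
    · rw [e1]; positivity
    · rw [e2]; positivity
    · rw [e3]; positivity

/-- A closed half-plane cuts `convexHull ℝ T` in the hull of the points of `T` it contains, when
the boundary line meets the hull in a segment between two points of `T`. -/
lemma convexHull_inter_area_nonneg {T : Set (ℝ × ℝ)} {a b : ℝ × ℝ} (ha : a ∈ T) (hb : b ∈ T)
    (hline : ∀ x ∈ convexHull ℝ T, area a b x = 0 → x ∈ segment ℝ a b) :
    convexHull ℝ (T ∩ {x | 0 ≤ area a b x}) = convexHull ℝ T ∩ {x | 0 ≤ area a b x} := by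
  set A := T ∩ {x | 0 ≤ area a b x} with hA
  have haA : a ∈ A := ⟨ha, by simp [area]⟩
  have hbA : b ∈ A := ⟨hb, by simp [area, mul_comm]⟩
  apply subset_antisymm
  · exact convexHull_min (fun x hx => ⟨subset_convexHull ℝ T hx.1, hx.2⟩)
      ((convex_convexHull ℝ T).inter (convex_area_nonneg a b))
  · rintro x ⟨hx, hx0⟩
    set B := T ∩ {x | area a b x < 0} with hB
    have hT : T = A ∪ B := by
      ext y; simp only [hA, hB, Set.mem_union, Set.mem_inter_iff, Set.mem_ofPred_eq]
      have := le_or_gt 0 (area a b y)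
      tauto
    rcases B.eq_empty_or_nonempty with h0 | hBne
    · rwa [hT, h0, Set.union_empty] at hx
    have hxT := hx
    rw [hT, convexHull_union ⟨a, haA⟩ hBne, mem_convexJoin] at hx
    obtain ⟨y, hy, z, hz, r, t, hr, ht, hrt, rfl⟩ := hx
    have hy0 : 0 ≤ area a b y := area_nonneg_of_mem_convexHull (fun y hy => hy.2) hy
    have hz0 : area a b z < 0 :=
      convexHull_min (t := {x | area a b x < 0}) (fun y hy => hy.2) (convex_area_neg a b) hz
    have hyT : y ∈ convexHull ℝ T := convexHull_mono (fun _ h => h.1) hy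
    have hzT : z ∈ convexHull ℝ T := convexHull_mono (fun _ h => h.1) hz
    simp only [Set.mem_ofPred_eq] at hx0
    rw [area_combo _ _ _ _ hrt] at hx0
    rcases hy0.eq_or_lt with hy0 | hy0
    · have : t = 0 := by
        rw [← hy0] at hx0
        nlinarith
      subst this
      obtain rfl : r = 1 := by linarith
      simpa using hy
    have hd : 0 < area a b y - area a b z := by linarith
    set s := area a b y / (area a b y - area a b z) with hs
    have hs0 : 0 < s := by positivity
    have hs1 : s ≤ 1 := by rw [hs, div_le_one hd]; linarith
    have hts : t ≤ s := by
      rw [hs, le_div_iff₀ hd]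
      obtain rfl : r = 1 - t := by linarith
      linarith
    have hw0 : area a b ((1 - s) • y + s • z) = 0 := by
      rw [area_combo _ _ _ _ (by ring), hs]; field_simp; ring
    have hw : (1 - s) • y + s • z ∈ convexHull ℝ A :=
      segment_subset_convexHull haA hbA (hline _
        (convex_convexHull ℝ T hyT hzT (by linarith) hs0.le (by ring)) hw0)
    have hts1 : t / s ≤ 1 := by rw [div_le_one hs0]; exact hts
    have := convex_convexHull ℝ A hy hw (a := 1 - t / s) (b := t / s) (by linarith)
      (by positivity) (by ring)
    convert this using 1
    rw [smul_add, smul_smul, smul_smul, ← add_assoc, ← add_smul, div_mul_cancel₀ _ hs0.ne']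
    congr 2
    field_simp
    obtain rfl : r = 1 - t := by linarith
    ring

lemma Convex.combo_line_mem_interior {K : Set (ℝ × ℝ)} (hK : Convex ℝ K) {a b : ℝ × ℝ} {t s r : ℝ}
    (ht : (1 - t) • a + t • b ∈ interior K) (hs : (1 - s) • a + s • b ∈ K)
    (h : (t < r ∧ r < s) ∨ (s < r ∧ r < t)) : (1 - r) • a + r • b ∈ interior K := by
  have hne : s - t ≠ 0 := by rcases h with h | h <;> intro h0 <;> linarith
  have h0 : 0 < (s - r) / (s - t) := by
    rcases h with h | h
    · exact div_pos (by linarith) (by linarith)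
    · exact div_pos_of_neg_of_neg (by linarith) (by linarith)
  have h1 : 0 ≤ (r - t) / (s - t) := by
    rcases h with h | h
    · exact div_nonneg (by linarith) (by linarith)
    · exact div_nonneg_of_nonpos (by linarith) (by linarith)
  have := hK.combo_interior_self_mem_interior ht hs h0 h1 (by field_simp; ring)
  convert this using 1
  ext <;> simp only [Prod.fst_add, Prod.snd_add, Prod.smul_fst, Prod.smul_snd, smul_eq_mul] <;>
    field_simp <;> ring

lemma exists_combo_of_area_eq_zero {a b x : ℝ × ℝ} (hab : a ≠ b) (hx : area a b x = 0) :
    ∃ s : ℝ, x = (1 - s) • a + s • b := by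
  simp only [area] at hx
  by_cases h : b.1 - a.1 = 0
  · have h2 : b.2 - a.2 ≠ 0 := fun h2 => hab (by ext <;> linarith)
    refine ⟨(x.2 - a.2) / (b.2 - a.2), ?_⟩
    ext <;> simp only [Prod.fst_add, Prod.snd_add, Prod.smul_fst, Prod.smul_snd, smul_eq_mul] <;>
      field_simp <;> linarith
  · refine ⟨(x.1 - a.1) / (b.1 - a.1), ?_⟩
    ext <;> simp only [Prod.fst_add, Prod.snd_add, Prod.smul_fst, Prod.smul_snd, smul_eq_mul] <;>
      field_simp <;> linarith

/-- A chord of `K` through the interior with end points `a`, `b` on the boundary: where a point of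
its line lies. -/
lemma Convex.mem_chord_iff {K : Set (ℝ × ℝ)} (hK : Convex ℝ K) {a b : ℝ × ℝ} {t s : ℝ}
    (ha : a ∈ K) (hb : b ∈ K) (ha' : a ∉ interior K) (hb' : b ∉ interior K)
    (ht0 : 0 < t) (ht1 : t < 1) (ht : (1 - t) • a + t • b ∈ interior K) :
    ((1 - s) • a + s • b ∈ K ↔ 0 ≤ s ∧ s ≤ 1) ∧
      ((1 - s) • a + s • b ∈ interior K ↔ 0 < s ∧ s < 1) := by
  have e0 : (1 - (0 : ℝ)) • a + (0 : ℝ) • b = a := by simp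
  have e1 : (1 - (1 : ℝ)) • a + (1 : ℝ) • b = b := by simp
  have hin : (1 - s) • a + s • b ∈ K → 0 ≤ s ∧ s ≤ 1 := by
    intro hs
    by_contra hcon
    rw [not_and_or, not_le, not_le] at hcon
    rcases hcon with h | h
    · exact ha' (e0 ▸ hK.combo_line_mem_interior ht hs (Or.inr ⟨h, ht0⟩))
    · exact hb' (e1 ▸ hK.combo_line_mem_interior ht hs (Or.inl ⟨ht1, h⟩))
  refine ⟨⟨hin, fun h => hK ha hb (by linarith) h.1 (by ring)⟩, fun hs => ?_, fun h => ?_⟩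
  · obtain ⟨h0, h1⟩ := hin (interior_subset hs)
    refine ⟨h0.lt_of_ne ?_, h1.lt_of_ne ?_⟩
    · rintro rfl; exact ha' (e0 ▸ hs)
    · rintro rfl; exact hb' (e1 ▸ hs)
  · rcases lt_trichotomy s t with hst | rfl | hst
    · exact hK.combo_line_mem_interior ht (s := 0) (by rwa [e0]) (Or.inr ⟨h.1, hst⟩)
    · exact ht
    · exact hK.combo_line_mem_interior ht (s := 1) (by rwa [e1]) (Or.inl ⟨hst, h.2⟩)

lemma toR_injective : Function.Injective toR := by
  intro p q h
  simp only [toR, Prod.mk.injEq, Int.cast_inj] at h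
  exact Prod.ext h.1 h.2

/-- `L` is the set of all lattice points of a two-dimensional lattice polygon without interior
lattice points. -/
structure IsHollow (L : Finset (ℤ × ℤ)) : Prop where
  mem_of_mem_hull : ∀ p, toR p ∈ convexHull ℝ (toR '' ↑L) → p ∈ L
  notMem_interior : ∀ p, toR p ∉ interior (convexHull ℝ (toR '' (L : Set (ℤ × ℤ))))
  nonempty_interior : (interior (convexHull ℝ (toR '' (L : Set (ℤ × ℤ))))).Nonempty

/-- The lattice points of the interior of `2 • K`. -/
def halfPts (K : Set (ℝ × ℝ)) : Set (ℤ × ℤ) := {q | (2 : ℝ)⁻¹ • toR q ∈ interior K}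

lemma toR_mem_hull {L : Finset (ℤ × ℤ)} {p : ℤ × ℤ} (hp : p ∈ L) :
    toR p ∈ convexHull ℝ (toR '' (L : Set (ℤ × ℤ))) :=
  subset_convexHull ℝ _ ⟨p, hp, rfl⟩

namespace IsHollow

variable {L : Finset (ℤ × ℤ)} {a b : ℤ × ℤ} {t : ℝ}

lemma chord_iff (h : IsHollow L) (ha : a ∈ L) (hb : b ∈ L) (ht0 : 0 < t) (ht1 : t < 1)
    (ht : (1 - t) • toR a + t • toR b ∈ interior (convexHull ℝ (toR '' (L : Set (ℤ × ℤ)))))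
    (s : ℝ) :
    ((1 - s) • toR a + s • toR b ∈ convexHull ℝ (toR '' (L : Set (ℤ × ℤ))) ↔ 0 ≤ s ∧ s ≤ 1) ∧
      ((1 - s) • toR a + s • toR b ∈ interior (convexHull ℝ (toR '' (L : Set (ℤ × ℤ)))) ↔
        0 < s ∧ s < 1) :=
  (convex_convexHull ℝ _).mem_chord_iff (toR_mem_hull ha) (toR_mem_hull hb)
    (h.notMem_interior a) (h.notMem_interior b) ht0 ht1 ht

lemma chord_ne (h : IsHollow L)
    (ht : (1 - t) • toR a + t • toR b ∈ interior (convexHull ℝ (toR '' (L : Set (ℤ × ℤ))))) :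
    toR a ≠ toR b := by
  intro hab
  rw [← hab, ← add_smul, sub_add_cancel, one_smul] at ht
  exact h.notMem_interior a ht

open Classical in
/-- The part of a hollow polygon on one side of a chord. -/
lemma filter_side (h : IsHollow L) (ha : a ∈ L) (hb : b ∈ L) (ht0 : 0 < t) (ht1 : t < 1)
    (ht : (1 - t) • toR a + t • toR b ∈ interior (convexHull ℝ (toR '' (L : Set (ℤ × ℤ))))) :
    IsHollow (L.filter fun p => 0 ≤ area (toR a) (toR b) (toR p)) ∧
    (L.filter fun p => 0 ≤ area (toR a) (toR b) (toR p)).card < L.card ∧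
    halfPts (convexHull ℝ (toR '' ((L.filter fun p => 0 ≤ area (toR a) (toR b) (toR p)) :
      Set (ℤ × ℤ)))) = halfPts (convexHull ℝ (toR '' (L : Set (ℤ × ℤ)))) ∩
        {q | 0 < area (toR a) (toR b) ((2 : ℝ)⁻¹ • toR q)} := by
  have hab := h.chord_ne ht
  have hm0 : area (toR a) (toR b) ((1 - t) • toR a + t • toR b) = 0 := by
    rw [area_combo _ _ _ _ (by ring)]
    simp only [area]; ring
  have himage : toR '' ((L.filter fun p => 0 ≤ area (toR a) (toR b) (toR p)) : Finset (ℤ × ℤ)) =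
      toR '' (L : Set (ℤ × ℤ)) ∩ {x | 0 ≤ area (toR a) (toR b) x} := by
    ext x
    simp only [Set.mem_image, Finset.mem_coe, Finset.mem_filter, Set.mem_inter_iff,
      Set.mem_ofPred_eq]
    constructor
    · rintro ⟨p, ⟨h1, h2⟩, rfl⟩; exact ⟨⟨p, h1, rfl⟩, h2⟩
    · rintro ⟨⟨p, h1, rfl⟩, h2⟩; exact ⟨p, ⟨h1, h2⟩, rfl⟩
  have hhull := convexHull_inter_area_nonneg (T := toR '' (L : Set (ℤ × ℤ))) ⟨a, ha, rfl⟩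
    ⟨b, hb, rfl⟩ (fun x hx hx0 => by
      obtain ⟨s, rfl⟩ := exists_combo_of_area_eq_zero hab hx0
      obtain ⟨h0, h1⟩ := (h.chord_iff ha hb ht0 ht1 ht s).1.1 hx
      exact ⟨1 - s, s, by linarith, h0, by ring, rfl⟩)
  have hint := congrArg interior hhull
  rw [interior_inter, interior_area_nonneg hab] at hint
  simp only [← himage] at hhull hint
  refine ⟨⟨fun p hp => ?_, fun p hp => ?_, ?_⟩, ?_, ?_⟩
  · rw [hhull] at hp
    exact Finset.mem_filter.2 ⟨h.mem_of_mem_hull p hp.1, hp.2⟩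
  · rw [hint] at hp
    exact h.notMem_interior p hp.1
  · rw [hint]
    by_contra hne
    have hle : ∀ y ∈ interior (convexHull ℝ (toR '' (L : Set (ℤ × ℤ)))),
        0 ≤ area (toR b) (toR a) y := by
      intro y hy
      by_contra hy0
      rw [area_swap] at hy0
      exact hne ⟨y, hy, by rw [Set.mem_ofPred_eq]; linarith⟩
    have := area_pos_of_mem_interior hab.symm hle (by rwa [interior_interior])
    rw [area_swap, hm0] at this
    simp at this
  · refine Finset.card_lt_card (Finset.filter_ssubset.2 ?_)
    by_contra! hcon
    have := area_pos_of_mem_interior hab (fun y hy => area_nonneg_of_mem_convexHull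
      (T := toR '' (L : Set (ℤ × ℤ))) (by rintro _ ⟨p, hp, rfl⟩; exact hcon p hp) hy) ht
    rw [hm0] at this
    exact this.false
  · ext q
    simp only [halfPts, hint, Set.mem_ofPred_eq, Set.mem_inter_iff]

lemma halfPts_inter_line (h : IsHollow L) (ha : a ∈ L) (hb : b ∈ L) (ht0 : 0 < t) (ht1 : t < 1)
    (ht : (1 - t) • toR a + t • toR b ∈ interior (convexHull ℝ (toR '' (L : Set (ℤ × ℤ))))) :
    halfPts (convexHull ℝ (toR '' (L : Set (ℤ × ℤ)))) ∩
        {q | area (toR a) (toR b) ((2 : ℝ)⁻¹ • toR q) = 0} = {a + b} := by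
  have hab := h.chord_ne ht
  have hch := fun s => (h.chord_iff ha hb ht0 ht1 ht s).2
  ext q
  constructor
  · rintro ⟨hq, hq0⟩
    obtain ⟨s, hs⟩ := exists_combo_of_area_eq_zero hab hq0
    simp only [halfPts, Set.mem_ofPred_eq] at hq
    rw [hs, hch] at hq
    have hq2 : toR q = (2 - 2 * s) • toR a + (2 * s) • toR b := by
      have := congrArg ((2 : ℝ) • ·) hs
      simp only [smul_smul, smul_add, mul_inv_cancel₀ (two_ne_zero' ℝ), one_smul] at this
      rw [this]; congr 2; ring
    have h1 : toR (q - a) = (1 - 2 * s) • toR a + (2 * s) • toR b := by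
      have : toR (q - a) = toR q - toR a := by simp [toR]
      rw [this, hq2]; module
    have h2 : toR (q - b) = (1 - (2 * s - 1)) • toR a + (2 * s - 1) • toR b := by
      have : toR (q - b) = toR q - toR b := by simp [toR]
      rw [this, hq2]; module
    have h3 := h.notMem_interior (q - a)
    have h4 := h.notMem_interior (q - b)
    rw [h1, hch] at h3
    rw [h2, hch] at h4
    have hs2 : 2 * s = 1 := by
      rcases lt_trichotomy (2 * s) 1 with h5 | h5 | h5
      · exact absurd ⟨by linarith, h5⟩ h3
      · exact h5
      · exact absurd ⟨by linarith, by linarith⟩ h4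
    apply toR_injective
    rw [hq2, show 2 - 2 * s = 1 by linarith, hs2]
    simp [toR]
  · rintro rfl
    have e : (2 : ℝ)⁻¹ • toR (a + b) = (1 - 2⁻¹ : ℝ) • toR a + (2⁻¹ : ℝ) • toR b := by
      ext <;> simp [toR] <;> ring
    refine ⟨?_, ?_⟩
    · simp only [halfPts, Set.mem_ofPred_eq]
      rw [e, hch]; norm_num
    · simp only [Set.mem_ofPred_eq]
      rw [e, area_combo _ _ _ _ (by ring)]
      simp only [area]; ring

open Classical in
lemma filter_side_inter (h : IsHollow L) (ha : a ∈ L) (hb : b ∈ L) (ht0 : 0 < t) (ht1 : t < 1)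
    (ht : (1 - t) • toR a + t • toR b ∈ interior (convexHull ℝ (toR '' (L : Set (ℤ × ℤ))))) :
    (L.filter fun p => 0 ≤ area (toR a) (toR b) (toR p)) ∩
      (L.filter fun p => 0 ≤ area (toR b) (toR a) (toR p)) = {a, b} := by
  have hab := h.chord_ne ht
  have hch := h.chord_iff ha hb ht0 ht1 ht
  ext p
  simp only [Finset.mem_inter, Finset.mem_filter, Finset.mem_insert, Finset.mem_singleton]
  constructor
  · rintro ⟨⟨hp, h1⟩, -, h2⟩
    rw [area_swap] at h2
    obtain ⟨s, hs⟩ := exists_combo_of_area_eq_zero (x := toR p) hab (by linarith)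
    have h3 := toR_mem_hull hp
    have h4 := h.notMem_interior p
    rw [hs, (hch s).1] at h3
    rw [hs, (hch s).2] at h4
    rcases h3.1.eq_or_lt with h5 | h5
    · left; apply toR_injective; rw [hs, ← h5]; simp
    · right; apply toR_injective
      obtain rfl : s = 1 := by
        by_contra h6; exact h4 ⟨h5, h3.2.lt_of_ne h6⟩
      rw [hs]; simp
  · rintro (rfl | rfl)
    · exact ⟨⟨ha, by simp [area]⟩, ha, by simp [area, mul_comm]⟩
    · exact ⟨⟨hb, by simp [area, mul_comm]⟩, hb, by simp [area]⟩

/-- No chord between lattice points passes through the interior. -/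
def NoChord (L : Finset (ℤ × ℤ)) : Prop :=
  ∀ a ∈ L, ∀ b ∈ L, ∀ t : ℝ, 0 < t → t < 1 →
    (1 - t) • toR a + t • toR b ∉ interior (convexHull ℝ (toR '' (L : Set (ℤ × ℤ))))

lemma area_nonneg_of_noChord (h : IsHollow L) (hno : NoChord L) {u v w x : ℤ × ℤ} (hu : u ∈ L)
    (hv : v ∈ L) (hw : w ∈ L) (hx : x ∈ L) (hD : 0 < area (toR u) (toR v) (toR w)) :
    0 ≤ area (toR v) (toR w) (toR x) := by
  by_contra! hα
  have hK := convex_convexHull ℝ (toR '' (L : Set (ℤ × ℤ)))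
  have hsum := area_add_area_add_area (toR u) (toR v) (toR w) (toR x)
  have hcr := area_smul_eq (toR u) (toR v) (toR w) (toR x)
  have hu' := toR_mem_hull hu
  have hv' := toR_mem_hull hv
  have hw' := toR_mem_hull hw
  have hx' := toR_mem_hull hx
  have hβ : area (toR w) (toR u) (toR x) = area (toR u) (toR x) (toR w) :=
    (area_rotate _ _ _).symm
  have hno' := hno v hv w hw
  have hi1 := h.notMem_interior w
  have hi2 := h.notMem_interior v
  have hγ' : area (toR u) (toR x) (toR v) = - area (toR u) (toR v) (toR x) := by
    simp only [area]; ring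
  generalize hDe : area (toR u) (toR v) (toR w) = D at *
  generalize hαe : area (toR v) (toR w) (toR x) = α at *
  generalize hβe : area (toR w) (toR u) (toR x) = β at *
  generalize hγe : area (toR u) (toR v) (toR x) = γ at *
  have h1 := congrArg Prod.fst hcr
  have h2 := congrArg Prod.snd hcr
  simp only [Prod.fst_add, Prod.snd_add, Prod.smul_fst, Prod.smul_snd, smul_eq_mul] at h1 h2
  by_cases hγ : 0 < γ
  · by_cases hβ0 : 0 ≤ β
    · have hpos : 0 < β + γ := by linarith
      refine hno' (γ / (2 * (β + γ))) (by positivity) ?_ ?_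
      · rw [div_lt_one (by positivity)]; linarith
      · have := combo_mem_interior hK hu' hv' hx' (by rw [hγe]; exact hγ.ne')
          (r := -α / (2 * (β + γ))) (s := 2⁻¹) (t := D / (2 * (β + γ)))
          (div_pos (by linarith) (by positivity)) (by norm_num) (by positivity)
          (by field_simp; linarith)
        convert this using 1
        ext <;> simp only [Prod.fst_add, Prod.snd_add, Prod.smul_fst, Prod.smul_snd,
          smul_eq_mul] <;> field_simp <;> linarith
    · apply hi1
      have := combo_mem_interior hK hu' hv' hx' (by rw [hγe]; exact hγ.ne')
        (r := -α / γ) (s := -β / γ) (t := D / γ)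
        (div_pos (by linarith) hγ) (div_pos (by linarith) hγ) (by positivity)
        (by field_simp; linarith)
      convert this using 1
      ext <;> simp only [Prod.fst_add, Prod.snd_add, Prod.smul_fst, Prod.smul_snd,
        smul_eq_mul] <;> field_simp <;> linarith
  · have hβ0 : 0 < β := by linarith
    have hne : area (toR u) (toR x) (toR w) ≠ 0 := by rw [← hβ]; exact hβ0.ne'
    rcases (not_lt.1 hγ).eq_or_lt with hγ0 | hγ0
    · subst hγ0
      refine hno' 2⁻¹ (by norm_num) (by norm_num) ?_
      have := combo_mem_interior hK hu' hx' hw' hne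
        (r := -α / (2 * β)) (s := D / (2 * β)) (t := 2⁻¹)
        (div_pos (by linarith) (by positivity)) (by positivity) (by norm_num)
        (by field_simp; linarith)
      convert this using 1
      ext <;> simp only [Prod.fst_add, Prod.snd_add, Prod.smul_fst, Prod.smul_snd,
        smul_eq_mul] <;> field_simp <;> linarith
    · apply hi2
      have := combo_mem_interior hK hu' hx' hw' hne
        (r := -α / β) (s := D / β) (t := -γ / β)
        (div_pos (by linarith) hβ0) (by positivity) (div_pos (by linarith) hβ0)
        (by field_simp; linarith)
      convert this using 1
      ext <;> simp only [Prod.fst_add, Prod.snd_add, Prod.smul_fst, Prod.smul_snd,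
        smul_eq_mul] <;> field_simp <;> linarith

lemma exists_area_pos (h : IsHollow L) :
    ∃ u ∈ L, ∃ v ∈ L, ∃ w ∈ L, 0 < area (toR u) (toR v) (toR w) := by
  obtain ⟨m, hm⟩ := h.nonempty_interior
  have hside : ∀ a b : ℝ × ℝ, a ≠ b → ∃ w ∈ L, area a b (toR w) ≠ 0 := by
    intro a b hab
    by_contra! hcon
    have hpos : ∀ c d : ℝ × ℝ, c ≠ d → (∀ p ∈ L, 0 ≤ area c d (toR p)) → 0 < area c d m := by
      intro c d hne hcd
      refine area_pos_of_mem_interior hne (fun y hy => area_nonneg_of_mem_convexHull ?_ hy) hm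
      rintro _ ⟨p, hp, rfl⟩
      exact hcd p hp
    have h1 := hpos a b hab fun p hp => (hcon p hp).ge
    have h2 := hpos b a hab.symm fun p hp => by rw [area_swap, hcon p hp, neg_zero]
    rw [area_swap] at h2
    linarith
  obtain ⟨u, hu, -⟩ := hside (0, 0) (1, 0) (by simp)
  have : ∃ v ∈ L, toR u ≠ toR v := by
    by_contra! hcon
    have : toR '' (L : Set (ℤ × ℤ)) ⊆ {toR u} := by
      rintro _ ⟨p, hp, rfl⟩
      exact (hcon p hp).symm
    have h1 := interior_mono (convexHull_mono (𝕜 := ℝ) this) hm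
    rw [convexHull_singleton, interior_singleton] at h1
    exact h1
  obtain ⟨v, hv, huv⟩ := this
  obtain ⟨w, hw, h1⟩ := hside _ _ huv
  rcases h1.lt_or_gt with h1 | h1
  · exact ⟨v, hv, u, hu, w, hw, by rw [area_swap]; linarith⟩
  · exact ⟨u, hu, v, hv, w, hw, h1⟩

/-- A lattice point `x` on the inner side of two edges of a lattice triangle would give a chord to
their common vertex `u`. -/
lemma false_of_noChord_of_area_pos (h : IsHollow L) (hno : NoChord L) {u v w x : ℤ × ℤ}
    (hu : u ∈ L) (hv : v ∈ L) (hw : w ∈ L) (hx : x ∈ L)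
    (hD : 0 < area (toR u) (toR v) (toR w)) (h2 : 0 < area (toR w) (toR u) (toR x))
    (h3 : 0 < area (toR u) (toR v) (toR x)) : False := by
  have hK := convex_convexHull ℝ (toR '' (L : Set (ℤ × ℤ)))
  have h1 := h.area_nonneg_of_noChord hno hu hv hw hx hD
  refine hno u hu x hx 2⁻¹ (by norm_num) (by norm_num) ?_
  refine mem_interior_of_area_pos hK (toR_mem_hull hu) (toR_mem_hull hv) (toR_mem_hull hw) ?_ ?_ ?_
  · have : area (toR v) (toR w) (toR u) = area (toR u) (toR v) (toR w) := area_rotate _ _ _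
    rw [area_combo _ _ _ _ (by ring), this]
    linarith
  · have : area (toR w) (toR u) (toR u) = 0 := by simp only [area]; ring
    rw [area_combo _ _ _ _ (by ring), this]
    linarith
  · have : area (toR u) (toR v) (toR u) = 0 := by simp only [area]; ring
    rw [area_combo _ _ _ _ (by ring), this]
    linarith

/-- A hollow polygon without chords is a triangle, with no lattice points in the interior of its
double. -/
lemma card_and_halfPts_of_noChord (h : IsHollow L) (hno : NoChord L) :
    L.card = 3 ∧ halfPts (convexHull ℝ (toR '' (L : Set (ℤ × ℤ)))) = ∅ := by
  have hK := convex_convexHull ℝ (toR '' (L : Set (ℤ × ℤ)))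
  obtain ⟨u, hu, v, hv, w, hw, hD⟩ := h.exists_area_pos
  have hD2 : 0 < area (toR v) (toR w) (toR u) := (area_rotate _ _ _).symm ▸ hD
  have hD3 : 0 < area (toR w) (toR u) (toR v) := (area_rotate _ _ _).symm ▸ hD2
  have n1 : ∀ x ∈ L, 0 ≤ area (toR v) (toR w) (toR x) := fun x hx =>
    h.area_nonneg_of_noChord hno hu hv hw hx hD
  have n2 : ∀ x ∈ L, 0 ≤ area (toR w) (toR u) (toR x) := fun x hx =>
    h.area_nonneg_of_noChord hno hv hw hu hx hD2
  have n3 : ∀ x ∈ L, 0 ≤ area (toR u) (toR v) (toR x) := fun x hx =>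
    h.area_nonneg_of_noChord hno hw hu hv hx hD3
  have p1 : ∀ x ∈ L, 0 < area (toR w) (toR u) (toR x) → 0 < area (toR u) (toR v) (toR x) → False :=
    fun x hx => h.false_of_noChord_of_area_pos hno hu hv hw hx hD
  have p2 : ∀ x ∈ L, 0 < area (toR u) (toR v) (toR x) → 0 < area (toR v) (toR w) (toR x) → False :=
    fun x hx => h.false_of_noChord_of_area_pos hno hv hw hu hx hD2
  have p3 : ∀ x ∈ L, 0 < area (toR v) (toR w) (toR x) → 0 < area (toR w) (toR u) (toR x) → False :=
    fun x hx => h.false_of_noChord_of_area_pos hno hw hu hv hx hD3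
  have huv : u ≠ v := by rintro rfl; simp [area] at hD
  have hvw : v ≠ w := by rintro rfl; simp [area] at hD2
  have hwu : w ≠ u := by rintro rfl; simp [area] at hD3
  constructor
  · have : L = {u, v, w} := by
      ext x
      simp only [Finset.mem_insert, Finset.mem_singleton]
      constructor
      · intro hx
        have hsum := area_add_area_add_area (toR u) (toR v) (toR w) (toR x)
        have hcr := eq_combo_of_area_ne_zero (toR x) hD.ne'
        have hcoord : ∀ {p : ℤ × ℤ}, toR x = toR p → x = p := fun hp => toR_injective hp
        rcases (n1 x hx).eq_or_lt with e1 | e1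
        · rcases (n2 x hx).eq_or_lt with e2 | e2
          · right; right
            rw [← e1, ← e2, zero_add, zero_add] at hsum
            rw [← e1, ← e2, hsum, div_self hD.ne'] at hcr
            exact hcoord (by simpa using hcr)
          · rcases (n3 x hx).eq_or_lt with e3 | e3
            · right; left
              rw [← e1, ← e3, zero_add, add_zero] at hsum
              rw [← e1, ← e3, hsum, div_self hD.ne'] at hcr
              exact hcoord (by simpa using hcr)
            · exact (p1 x hx e2 e3).elim
        · rcases (n2 x hx).eq_or_lt with e2 | e2
          · rcases (n3 x hx).eq_or_lt with e3 | e3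
            · left
              rw [← e2, ← e3, add_zero, add_zero] at hsum
              rw [← e2, ← e3, hsum, div_self hD.ne'] at hcr
              exact hcoord (by simpa using hcr)
            · exact (p2 x hx e3 e1).elim
          · exact (p3 x hx e1 e2).elim
      · rintro (rfl | rfl | rfl) <;> assumption
    rw [this, Finset.card_eq_three]
    exact ⟨u, v, w, huv, hwu.symm, hvw, rfl⟩
  · rw [Set.eq_empty_iff_forall_notMem]
    intro q hq
    simp only [halfPts, Set.mem_ofPred_eq] at hq
    have hpos : ∀ c d : ℤ × ℤ, c ≠ d → (∀ x ∈ L, 0 ≤ area (toR c) (toR d) (toR x)) →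
        0 < area (toR c) (toR d) ((2 : ℝ)⁻¹ • toR q) := by
      intro c d hne hcd
      refine area_pos_of_mem_interior (toR_injective.ne hne)
        (fun y hy => area_nonneg_of_mem_convexHull ?_ hy) hq
      rintro _ ⟨p, hp, rfl⟩
      exact hcd p hp
    have q1 := hpos v w hvw n1
    have q2 := hpos w u hwu n2
    have q3 := hpos u v huv n3
    have hsum := area_add_area_add_area (toR u) (toR v) (toR w) ((2 : ℝ)⁻¹ • toR q)
    have hmem : ∀ x, 0 ≤ area (toR v) (toR w) (toR x) → 0 ≤ area (toR w) (toR u) (toR x) →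
        0 ≤ area (toR u) (toR v) (toR x) → x ∈ L := fun x h1 h2 h3 => h.mem_of_mem_hull x
      (mem_of_area_nonneg hK (toR_mem_hull hu) (toR_mem_hull hv) (toR_mem_hull hw) hD h1 h2 h3)
    have hsub : ∀ a b c : ℤ × ℤ, area (toR a) (toR b) (toR (q - c)) =
        2 * area (toR a) (toR b) ((2 : ℝ)⁻¹ • toR q) - area (toR a) (toR b) (toR c) := by
      intro a b c
      simp only [area, toR, Prod.fst_sub, Prod.snd_sub, Prod.smul_mk, smul_eq_mul, Int.cast_sub]
      ring
    have z1 : ∀ a b : ℤ × ℤ, area (toR a) (toR b) (toR a) = 0 := by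
      intro a b; simp only [area]; ring
    have z2 : ∀ a b : ℤ × ℤ, area (toR a) (toR b) (toR b) = 0 := by
      intro a b; simp only [area]; ring
    have r2 : area (toR v) (toR w) (toR u) = area (toR u) (toR v) (toR w) := area_rotate _ _ _
    have r3 : area (toR w) (toR u) (toR v) = area (toR u) (toR v) (toR w) := by
      rw [← r2]; exact area_rotate _ _ _
    by_cases c1 : area (toR u) (toR v) (toR w) ≤ 2 * area (toR v) (toR w) ((2 : ℝ)⁻¹ • toR q)
    · have a1 := hsub v w u
      have a2 := hsub w u u
      have a3 := hsub u v u
      rw [z1] at a3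
      rw [z2] at a2
      exact p1 (q - u) (hmem _ (by linarith) (by linarith) (by linarith)) (by linarith)
        (by linarith)
    by_cases c2 : area (toR u) (toR v) (toR w) ≤ 2 * area (toR w) (toR u) ((2 : ℝ)⁻¹ • toR q)
    · have a1 := hsub v w v
      have a2 := hsub w u v
      have a3 := hsub u v v
      rw [z1] at a1
      rw [z2] at a3
      exact p2 (q - v) (hmem _ (by linarith) (by linarith) (by linarith)) (by linarith)
        (by linarith)
    by_cases c3 : area (toR u) (toR v) (toR w) ≤ 2 * area (toR u) (toR v) ((2 : ℝ)⁻¹ • toR q)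
    · have a1 := hsub v w w
      have a2 := hsub w u w
      have a3 := hsub u v w
      rw [z1] at a2
      rw [z2] at a1
      exact p3 (q - w) (hmem _ (by linarith) (by linarith) (by linarith)) (by linarith)
        (by linarith)
    have hrefl : ∀ a b : ℤ × ℤ, area (toR a) (toR b) (toR (u + v + w - q)) =
        area (toR a) (toR b) (toR u) + area (toR a) (toR b) (toR v) + area (toR a) (toR b) (toR w)
          - 2 * area (toR a) (toR b) ((2 : ℝ)⁻¹ • toR q) := by
      intro a b
      simp only [area, toR, Prod.fst_sub, Prod.snd_sub, Prod.fst_add, Prod.snd_add, Prod.smul_mk,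
        smul_eq_mul, Int.cast_sub, Int.cast_add]
      ring
    have a1 := hrefl v w
    have a2 := hrefl w u
    have a3 := hrefl u v
    rw [z1, z2] at a1 a2 a3
    exact p1 (u + v + w - q) (hmem _ (by linarith) (by linarith) (by linarith)) (by linarith)
      (by linarith)

open Classical in
/-- Chords cut a hollow polygon into hollow triangles, and each contributes the midpoint of its
end points. -/
theorem finite_halfPts_and_ncard {n : ℕ} : ∀ {L : Finset (ℤ × ℤ)}, IsHollow L → L.card = n →
    (halfPts (convexHull ℝ (toR '' (L : Set (ℤ × ℤ))))).Finite ∧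
      (halfPts (convexHull ℝ (toR '' (L : Set (ℤ × ℤ))))).ncard + 3 = n := by
  induction n using Nat.strong_induction_on with
  | _ n ih =>
  intro L h hn
  by_cases hno : NoChord L
  · obtain ⟨h1, h2⟩ := h.card_and_halfPts_of_noChord hno
    rw [h2]
    exact ⟨Set.finite_empty, by simp; omega⟩
  · simp only [NoChord] at hno
    push Not at hno
    obtain ⟨a, ha, b, hb, t, ht0, ht1, ht⟩ := hno
    have ht' : (1 - (1 - t)) • toR b + (1 - t) • toR a ∈
        interior (convexHull ℝ (toR '' (L : Set (ℤ × ℤ)))) := by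
      convert ht using 1; rw [add_comm, sub_sub_cancel]
    obtain ⟨hA, cA, eA⟩ := h.filter_side ha hb ht0 ht1 ht
    obtain ⟨hB, cB, eB⟩ := h.filter_side hb ha (t := 1 - t) (by linarith) (by linarith) ht'
    have hline := h.halfPts_inter_line ha hb ht0 ht1 ht
    have hcap := h.filter_side_inter ha hb ht0 ht1 ht
    have hcup : (L.filter fun p => 0 ≤ area (toR a) (toR b) (toR p)) ∪
        (L.filter fun p => 0 ≤ area (toR b) (toR a) (toR p)) = L := by
      ext p
      simp only [Finset.mem_union, Finset.mem_filter, area_swap (toR a) (toR b), Left.nonneg_neg_iff]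
      have := le_total 0 (area (toR a) (toR b) (toR p))
      tauto
    have hcard := Finset.card_union_add_card_inter
      (L.filter fun p => 0 ≤ area (toR a) (toR b) (toR p))
      (L.filter fun p => 0 ≤ area (toR b) (toR a) (toR p))
    rw [hcup, hcap, Finset.card_pair (fun hab => h.chord_ne ht (congrArg toR hab))] at hcard
    obtain ⟨fA, nA⟩ := ih _ (hn ▸ cA) hA rfl
    obtain ⟨fB, nB⟩ := ih _ (hn ▸ cB) hB rfl
    rw [eA] at fA nA
    rw [eB] at fB nB
    set H := halfPts (convexHull ℝ (toR '' (L : Set (ℤ × ℤ))))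
    have hH : H = ((H ∩ {q | 0 < area (toR a) (toR b) ((2 : ℝ)⁻¹ • toR q)}) ∪
        (H ∩ {q | 0 < area (toR b) (toR a) ((2 : ℝ)⁻¹ • toR q)})) ∪ {a + b} := by
      rw [← hline, ← Set.inter_union_distrib_left, ← Set.inter_union_distrib_left, eq_comm,
        Set.inter_eq_left]
      intro q _
      simp only [Set.mem_union, Set.mem_ofPred_eq, area_swap (toR a) (toR b), Left.neg_pos_iff]
      have := lt_trichotomy 0 (area (toR a) (toR b) ((2 : ℝ)⁻¹ • toR q))
      tauto
    have hd1 : Disjoint (H ∩ {q | 0 < area (toR a) (toR b) ((2 : ℝ)⁻¹ • toR q)})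
        (H ∩ {q | 0 < area (toR b) (toR a) ((2 : ℝ)⁻¹ • toR q)}) := by
      rw [Set.disjoint_left]
      rintro q ⟨-, h1⟩ ⟨-, h2⟩
      simp only [Set.mem_ofPred_eq, area_swap (toR a) (toR b)] at h1 h2
      linarith
    have hd2 : Disjoint ((H ∩ {q | 0 < area (toR a) (toR b) ((2 : ℝ)⁻¹ • toR q)}) ∪
        (H ∩ {q | 0 < area (toR b) (toR a) ((2 : ℝ)⁻¹ • toR q)})) {a + b} := by
      rw [← hline, Set.disjoint_left]
      rintro q (⟨-, h1⟩ | ⟨-, h1⟩) ⟨-, h2⟩ <;>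
      simp only [Set.mem_ofPred_eq, area_swap (toR a) (toR b)] at h1 h2 <;> linarith
    rw [hH]
    refine ⟨(fA.union fB).union (Set.finite_singleton _), ?_⟩
    rw [Set.ncard_union_eq hd2 (fA.union fB) (Set.finite_singleton _),
      Set.ncard_union_eq hd1 fA fB, Set.ncard_singleton]
    omega

end IsHollow

lemma nonempty_interior_of_not_collinear {K : Set (ℝ × ℝ)} (hK : Convex ℝ K)
    (h : ¬ Collinear ℝ K) : (interior K).Nonempty := by
  rw [hK.interior_nonempty_iff_affineSpan_eq_top]
  by_contra hne
  apply h
  rw [collinear_iff_finrank_le_one]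
  have hKne : K.Nonempty := by
    rw [Set.nonempty_iff_ne_empty]
    rintro rfl
    exact h (collinear_empty ℝ _)
  have htop : vectorSpan ℝ K ≠ ⊤ := fun htop =>
    hne ((AffineSubspace.affineSpan_eq_top_iff_vectorSpan_eq_top_of_nonempty ℝ _ _ hKne).2 htop)
  have := Submodule.finrank_lt htop
  rw [Module.finrank_prod, Module.finrank_self] at this
  omega

theorem stmt9 (P : Set (ℝ × ℝ))
    (hpoly : IsLatticePolygon P) (hdim : ¬ Collinear ℝ P)
    (hint : latticePts (interior P) = ∅) :
    (latticePts (interior ((2 : ℝ) • P))).ncard = (latticePts P).ncard - 3 := by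
  obtain ⟨S, rfl⟩ := hpoly
  set P := convexHull ℝ (toR '' (S : Set (ℤ × ℤ))) with hP
  have hfin : (latticePts P).Finite := finite_latticePts_of_isBounded
    (isBounded_convexHull.2 (S.finite_toSet.image toR).isBounded)
  have hhull : convexHull ℝ (toR '' (hfin.toFinset : Set (ℤ × ℤ))) = P := by
    rw [hfin.coe_toFinset]
    apply subset_antisymm
    · refine convexHull_min ?_ (convex_convexHull ℝ _)
      rintro _ ⟨p, hp, rfl⟩
      exact hp
    · exact convexHull_mono (Set.image_mono fun p hp => toR_mem_hull hp)
  have hL : IsHollow hfin.toFinset := by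
    constructor
    · intro p hp
      rw [hhull] at hp
      exact hfin.mem_toFinset.2 hp
    · intro p hp
      rw [hhull] at hp
      exact Set.eq_empty_iff_forall_notMem.1 hint p hp
    · rw [hhull]
      exact nonempty_interior_of_not_collinear (convex_convexHull ℝ _) hdim
  have hcount := (hL.finite_halfPts_and_ncard rfl).2
  rw [hhull, ← Set.ncard_eq_toFinset_card _ hfin] at hcount
  have heq : latticePts (interior ((2 : ℝ) • P)) = halfPts P := by
    ext q
    simp only [latticePts, halfPts, Set.mem_ofPred_eq]
    rw [interior_smul₀ two_ne_zero, Set.mem_smul_set_iff_inv_smul_mem₀ two_ne_zero]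
  rw [heq]
  omega
end
end
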